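/- Let F be a nonarchimedean local field with ring of integers 𝔬, prime 𝔭, residue cardinality q, and ψ : F → ℂ^× a nontrivial additive character with conductor 𝔬. For ξ ∈ F with |ξ| > q², one has ∫_𝔬 ψ(x⁻¹ − ξx) dx = ∫_{|x|² = |ξ|⁻¹} ψ(x⁻¹ − ξx) dx; that is, the contribution of {x ∈ 𝔬 : |x|² ≠ |ξ|⁻¹} vanishes. -/

import Mathlib

open MeasureTheory

/-- `abs` is a discretely valued nonarchimedean absolute value on `F` with value group `q ^ ℤ`, and
`μ` is a translation invariant measure, finite on balls and normalised on the unit ball. -/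
structure IsUltrametricHaar {F : Type*} [Field F] [MeasurableSpace F]
    (μ : Measure F) (abs : F → ℝ) (q : ℝ) : Prop where
  one_lt : 1 < q
  meas : Measurable abs
  nonneg : ∀ x, 0 ≤ abs x
  eq_zero : ∀ x, abs x = 0 ↔ x = 0
  mul : ∀ x y, abs (x * y) = abs x * abs y
  add : ∀ x y, abs (x + y) ≤ max (abs x) (abs y)
  vals : ∀ x : F, x ≠ 0 → ∃ n : ℤ, abs x = q ^ n
  exists_eq : ∃ x, abs x = q
  inv : ∀ (a : F) (s : Set F), MeasurableSet s → μ ((fun x => a + x) ⁻¹' s) = μ s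
  fin : ∀ n : ℤ, μ {x : F | abs x ≤ q ^ n} < ⊤
  int : μ {x : F | abs x ≤ 1} = 1

namespace IsUltrametricHaar

variable {F : Type*} [Field F] [MeasurableSpace F] {μ : Measure F} {abs : F → ℝ} {q : ℝ}

lemma map_zero (hF : IsUltrametricHaar μ abs q) : abs 0 = 0 := (hF.eq_zero 0).2 rfl

lemma map_one (hF : IsUltrametricHaar μ abs q) : abs 1 = 1 := by
  have h1 : abs 1 ≠ 0 := fun h => one_ne_zero ((hF.eq_zero 1).1 h)
  have h2 := hF.mul 1 1
  rw [mul_one] at h2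
  exact (mul_right_cancel₀ h1 (by rw [one_mul]; exact h2)).symm

/-- The absolute value as a homomorphism of monoids with zero. -/
def hom (hF : IsUltrametricHaar μ abs q) : F →*₀ ℝ where
  toFun := abs
  map_zero' := hF.map_zero
  map_one' := hF.map_one
  map_mul' := hF.mul

lemma map_inv (hF : IsUltrametricHaar μ abs q) (x : F) : abs x⁻¹ = (abs x)⁻¹ :=
  map_inv₀ hF.hom x

lemma map_pow (hF : IsUltrametricHaar μ abs q) (x : F) (n : ℕ) : abs (x ^ n) = abs x ^ n :=
  _root_.map_pow hF.hom x n

lemma map_neg (hF : IsUltrametricHaar μ abs q) (x : F) : abs (-x) = abs x := by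
  have h1 : abs (-1) * abs (-1) = 1 := by rw [← hF.mul, neg_mul_neg, mul_one, hF.map_one]
  have h2 : abs (-1) = 1 := by nlinarith [hF.nonneg (-1)]
  rw [← neg_one_mul, hF.mul, h2, one_mul]

lemma sub (hF : IsUltrametricHaar μ abs q) (x y : F) : abs (x - y) ≤ max (abs x) (abs y) := by
  rw [sub_eq_add_neg, ← hF.map_neg y]
  exact hF.add x (-y)

lemma abs_sub_comm (hF : IsUltrametricHaar μ abs q) (x y : F) : abs (x - y) = abs (y - x) := by
  rw [← hF.map_neg, neg_sub]

lemma q_pos (hF : IsUltrametricHaar μ abs q) : 0 < q := one_pos.trans hF.one_lt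

lemma exists_eq_zpow (hF : IsUltrametricHaar μ abs q) (n : ℤ) : ∃ y, abs y = q ^ n := by
  obtain ⟨y, hy⟩ := hF.exists_eq
  exact ⟨y ^ n, by rw [← hy]; exact map_zpow₀ hF.hom y n⟩

lemma exists_le_zpow (hF : IsUltrametricHaar μ abs q) (x : F) : ∃ n : ℤ, abs x ≤ q ^ n := by
  by_cases hx : x = 0
  · exact ⟨0, by simp [hx, hF.map_zero]⟩
  · obtain ⟨n, hn⟩ := hF.vals x hx
    exact ⟨n, hn.le⟩

lemma zpow_mono (hF : IsUltrametricHaar μ abs q) {m n : ℤ} (h : m ≤ n) : q ^ m ≤ q ^ n :=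
  zpow_le_zpow_right₀ hF.one_lt.le h

lemma add_eq (hF : IsUltrametricHaar μ abs q) {x h : F} (hx : abs h < abs x) :
    abs (x + h) = abs x := by
  have h1 := hF.add x h
  rw [max_eq_left hx.le] at h1
  have h2 := hF.sub (x + h) h
  rw [add_sub_cancel_right] at h2
  exact le_antisymm h1 ((le_max_iff.1 h2).resolve_right hx.not_ge)

lemma add_eq_iff (hF : IsUltrametricHaar μ abs q) {x h : F} {r : ℝ} (hr : abs h < r) :
    abs (x + h) = r ↔ abs x = r := by
  constructor
  · intro hx
    have := hF.add_eq (x := x + h) (h := -h) (by rwa [hF.map_neg, hx])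
    rw [add_neg_cancel_right] at this
    rw [this, hx]
  · intro hx
    rw [hF.add_eq (by rwa [hx]), hx]

/-- The closed ball of radius `q ^ k` as an additive subgroup. -/
def ball (hF : IsUltrametricHaar μ abs q) (k : ℤ) : AddSubgroup F where
  carrier := {x | abs x ≤ q ^ k}
  zero_mem' := by
    simp only [Set.mem_ofPred_eq, hF.map_zero]
    exact (zpow_pos hF.q_pos k).le
  add_mem' := fun {a b} ha hb => (hF.add a b).trans (max_le ha hb)
  neg_mem' := fun {a} ha => by simpa only [Set.mem_ofPred_eq, hF.map_neg] using ha

lemma mem_ball (hF : IsUltrametricHaar μ abs q) {k : ℤ} {x : F} :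
    x ∈ hF.ball k ↔ abs x ≤ q ^ k := Iff.rfl

lemma measurableSet_ball (hF : IsUltrametricHaar μ abs q) (r : ℝ) :
    MeasurableSet {x | abs x ≤ r} := hF.meas measurableSet_Iic

lemma measurableSet_sphere (hF : IsUltrametricHaar μ abs q) (r : ℝ) :
    MeasurableSet {x | abs x = r} := hF.meas (measurableSet_singleton r)

lemma nullMeasurableSet_translate (hF : IsUltrametricHaar μ abs q) {s : Set F}
    (hs : MeasurableSet s) {n : ℤ} (hsn : s ⊆ {x | abs x ≤ q ^ n}) (t : F)
    (ht : abs t ≤ q ^ n) : NullMeasurableSet ((fun x => t + x) ⁻¹' s) μ := by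
  set B : Set F := {x | abs x ≤ q ^ n} with hB
  have hBm : MeasurableSet B := hF.measurableSet_ball _
  set X := (fun x => t + x) ⁻¹' s
  set Y := (fun x => t + x) ⁻¹' (B \ s)
  have hX : μ X = μ s := hF.inv t s hs
  have hY : μ Y = μ (B \ s) := hF.inv t _ (hBm.diff hs)
  have hadd : μ X + μ Y = μ B := by
    rw [hX, hY, ← measure_inter_add_sdiff B hs, Set.inter_eq_self_of_subset_right hsn]
  have hsub : B \ toMeasurable μ Y ⊆ X := by
    rintro x ⟨hxB, hxY⟩
    by_contra hxX
    exact hxY (subset_toMeasurable μ Y ⟨(hF.ball n).add_mem ht hxB, hxX⟩)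
  have hYfin : μ Y ≠ ⊤ := by
    rw [hY]
    exact ((measure_mono Set.sdiff_subset).trans_lt (hF.fin n)).ne
  have hXfin : μ X ≠ ⊤ := by
    rw [hX]
    exact ((measure_mono hsn).trans_lt (hF.fin n)).ne
  have hle : μ X ≤ μ (B \ toMeasurable μ Y) := by
    have h1 : μ B ≤ μ (B \ toMeasurable μ Y) + μ (toMeasurable μ Y) := by
      refine (measure_mono ?_).trans (measure_union_le _ _)
      rw [Set.sdiff_union_self]
      exact Set.subset_union_left
    rw [measure_toMeasurable, ← hadd] at h1
    exact (ENNReal.add_le_add_iff_right hYfin).1 h1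
  have hm : MeasurableSet (B \ toMeasurable μ Y) := hBm.diff (measurableSet_toMeasurable _ _)
  exact hm.nullMeasurableSet.congr
    (ae_eq_of_subset_of_measure_ge hsub hle hm.nullMeasurableSet hXfin)

lemma nullMeasurableSet_coset (hF : IsUltrametricHaar μ abs q) (c : F) (k : ℤ) :
    NullMeasurableSet {x | abs (x - c) ≤ q ^ k} μ := by
  obtain ⟨n, hn⟩ := hF.exists_le_zpow c
  have := hF.nullMeasurableSet_translate (hF.measurableSet_ball (q ^ k)) (n := max n k)
    (fun x hx => le_trans hx (hF.zpow_mono (le_max_right _ _))) (-c)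
    (by rw [hF.map_neg]; exact hn.trans (hF.zpow_mono (le_max_left _ _)))
  simpa only [Set.preimage_ofPred_eq, neg_add_eq_sub] using this

lemma measure_coset (hF : IsUltrametricHaar μ abs q) (c : F) (k : ℤ) :
    μ {x | abs (x - c) ≤ q ^ k} = μ {x | abs x ≤ q ^ k} := by
  rw [← hF.inv (-c) _ (hF.measurableSet_ball (q ^ k))]
  simp only [Set.preimage_ofPred_eq, neg_add_eq_sub]

lemma measure_zero_singleton (hF : IsUltrametricHaar μ abs q) : μ {(0 : F)} = 0 := by
  have hz : MeasurableSet {(0 : F)} := by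
    convert hF.meas (measurableSet_singleton (0 : ℝ)) using 1
    ext x
    simp [hF.eq_zero]
  obtain ⟨y, hy⟩ := hF.exists_eq_zpow (-1)
  have hy1 : abs y < 1 := by
    rw [hy, zpow_neg_one]
    exact inv_lt_one_of_one_lt₀ hF.one_lt
  have hy0 : 0 < abs y := by rw [hy]; exact zpow_pos hF.q_pos _
  have hinj : Function.Injective fun n : ℕ => y ^ n := by
    intro a b hab
    have : abs y ^ a = abs y ^ b := by rw [← hF.map_pow, ← hF.map_pow]; exact congrArg abs hab
    exact (pow_right_injective₀ hy0 hy1.ne) this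
  have hpre : ∀ c : F, (fun x => -c + x) ⁻¹' {(0 : F)} = {c} := by
    intro c
    ext x
    simp [eq_comm]
  have hle : ∀ n : ℕ, abs (y ^ n) ≤ q ^ (0 : ℤ) := fun n => by
    rw [hF.map_pow, zpow_zero]
    exact pow_le_one₀ hy0.le hy1.le
  by_contra h0
  have hfin := Measure.finite_const_le_meas_of_disjoint_iUnion₀ μ (pos_iff_ne_zero.2 h0)
    (As := fun n : ℕ => {y ^ n})
    (fun n => by
      rw [← hpre]
      refine hF.nullMeasurableSet_translate hz (n := 0) ?_ _ (by rw [hF.map_neg]; exact hle n)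
      simp [hF.map_zero])
    (fun a b hab => (Set.disjoint_singleton.2 (hinj.ne hab)).aedisjoint)
    (((measure_mono (Set.iUnion_subset fun n => Set.singleton_subset_iff.2 (hle n))).trans_lt
      (hF.fin 0)).ne)
  refine Set.infinite_univ (α := ℕ) (hfin.subset fun n _ => ?_)
  simp only [Set.mem_ofPred_eq]
  rw [← hpre (y ^ n), hF.inv _ _ hz]

/-- A ball has a finite system of representatives modulo translates of a smaller one. -/
lemma exists_representatives (hF : IsUltrametricHaar μ abs q) (k m : ℤ) :
    ∃ s : Finset F, ∀ x, abs x ≤ q ^ m →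
      ∃ c ∈ s, abs (x - c) ≤ q ^ k ∧ ∀ c' ∈ s, abs (x - c') ≤ q ^ k → c' = c := by
  classical
  wlog hk : k = 0 generalizing k m
  · obtain ⟨s, hs⟩ := this 0 (m - k) rfl
    obtain ⟨y, hy⟩ := hF.exists_eq_zpow k
    have hqk : 0 < q ^ k := zpow_pos hF.q_pos k
    have hy0 : y ≠ 0 := fun h => by
      rw [h, hF.map_zero] at hy
      exact hqk.ne hy
    have key : ∀ x c, abs (x - y * c) ≤ q ^ k ↔ abs (x * y⁻¹ - c) ≤ q ^ (0 : ℤ) := by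
      intro x c
      have : x - y * c = y * (x * y⁻¹ - c) := by field_simp
      rw [this, hF.mul, hy, zpow_zero]
      exact mul_le_iff_le_one_right hqk
    refine ⟨s.image (y * ·), fun x hx => ?_⟩
    obtain ⟨c, hc, hxc, hu⟩ := hs (x * y⁻¹) (by
      rw [hF.mul, hF.map_inv, hy, zpow_sub₀ hF.q_pos.ne', div_eq_mul_inv]
      gcongr)
    refine ⟨y * c, Finset.mem_image_of_mem _ hc, (key x c).2 hxc, fun c' hc' hxc' => ?_⟩
    obtain ⟨d, hd, rfl⟩ := Finset.mem_image.1 hc'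
    rw [hu d hd ((key x d).1 hxc')]
  subst hk
  set n := max m 0
  have hmk : ∀ x y : F, (x : F ⧸ hF.ball 0) = y ↔ abs (y - x) ≤ q ^ (0 : ℤ) := fun x y => by
    rw [QuotientAddGroup.eq, hF.mem_ball, neg_add_eq_sub]
  let ι := {c : F ⧸ hF.ball 0 // abs c.out ≤ q ^ n}
  have hfin := Measure.finite_const_le_meas_of_disjoint_iUnion₀ μ one_pos
    (As := fun c : ι => {x | abs (x - c.1.out) ≤ q ^ (0 : ℤ)})
    (fun c => hF.nullMeasurableSet_coset _ _)
    (fun a b hab => by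
      refine Disjoint.aedisjoint (Set.disjoint_left.2 fun x hxa hxb => hab (Subtype.ext ?_))
      rw [← a.1.out_eq', ← b.1.out_eq']
      exact ((hmk _ x).2 hxa).trans ((hmk _ x).2 hxb).symm)
    (((measure_mono (Set.iUnion_subset fun c x hx => by
      have h1 : x - c.1.out ∈ hF.ball n := le_trans hx (hF.zpow_mono (le_max_right _ _))
      have h2 := (hF.ball n).add_mem h1 c.2
      rwa [sub_add_cancel] at h2)).trans_lt (hF.fin n)).ne)
  have huniv : (Set.univ : Set ι).Finite := hfin.subset fun c _ => by
    simp only [Set.mem_ofPred_eq]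
    rw [hF.measure_coset, zpow_zero, hF.int]
  refine ⟨huniv.toFinset.image fun c => c.1.out, fun x hx => ?_⟩
  have hout : abs (x - (x : F ⧸ hF.ball 0).out) ≤ q ^ (0 : ℤ) :=
    (hmk _ x).1 (Quotient.out_eq' (x : F ⧸ hF.ball 0))
  have hmem : abs (x : F ⧸ hF.ball 0).out ≤ q ^ n := by
    have h1 : x - (x : F ⧸ hF.ball 0).out ∈ hF.ball n :=
      le_trans hout (hF.zpow_mono (le_max_right _ _))
    have h2 : x ∈ hF.ball n := le_trans hx (hF.zpow_mono (le_max_left _ _))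
    have h3 := (hF.ball n).sub_mem h2 h1
    rwa [sub_sub_cancel] at h3
  refine ⟨_, Finset.mem_image.2 ⟨⟨_, hmem⟩, by simp, rfl⟩, hout, fun c' hc' hxc' => ?_⟩
  obtain ⟨d, -, rfl⟩ := Finset.mem_image.1 hc'
  have h : d.1 = (x : F ⧸ hF.ball 0) := by
    rw [← d.1.out_eq']
    exact (hmk _ x).2 hxc'
  exact congrArg Quotient.out h

/-- A function with bounded support which is invariant under a ball is a finite linear combination
of indicators of translates of that ball. -/
lemma eq_sum_indicator (hF : IsUltrametricHaar μ abs q) {f : F → ℂ} {k m : ℤ}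
    (hf : ∀ x h, abs h ≤ q ^ k → f (x + h) = f x) (hf0 : ∀ x, q ^ m < abs x → f x = 0) :
    ∃ s : Finset F, ∀ x,
      f x = ∑ c ∈ s, {x | abs (x - c) ≤ q ^ k}.indicator (fun _ => f c) x := by
  obtain ⟨s, hs⟩ := hF.exists_representatives k m
  have hfc : ∀ x c, abs (x - c) ≤ q ^ k → f c = f x := fun x c hxc => by
    rw [← hf c _ hxc, add_sub_cancel]
  refine ⟨s, fun x => ?_⟩
  by_cases hx : abs x ≤ q ^ m
  · obtain ⟨c, hc, hxc, hu⟩ := hs x hx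
    rw [Finset.sum_eq_single_of_mem c hc]
    · rw [Set.indicator_of_mem (show x ∈ {x | abs (x - c) ≤ q ^ k} from hxc), hfc x c hxc]
    · intro d hd hdc
      exact Set.indicator_apply_eq_zero.2 fun hxd => absurd (hu d hd hxd) hdc
  · rw [hf0 x (not_le.1 hx)]
    refine (Finset.sum_eq_zero fun c _ => Set.indicator_apply_eq_zero.2 fun hxc => ?_).symm
    rw [hfc x c hxc, hf0 x (not_le.1 hx)]

lemma integrable_indicator_coset (hF : IsUltrametricHaar μ abs q) (a : ℂ) (c : F) (k : ℤ) :
    Integrable ({x | abs (x - c) ≤ q ^ k}.indicator fun _ => a) μ :=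
  (integrableOn_const (by rw [hF.measure_coset]; exact (hF.fin k).ne)).integrable_indicator₀
    (hF.nullMeasurableSet_coset c k)

lemma integral_indicator_coset (hF : IsUltrametricHaar μ abs q) (a : ℂ) (c : F) (k : ℤ) :
    ∫ x, {x | abs (x - c) ≤ q ^ k}.indicator (fun _ => a) x ∂μ =
      μ.real {x | abs x ≤ q ^ k} • a := by
  rw [integral_indicator₀ (hF.nullMeasurableSet_coset c k), setIntegral_const, Measure.real,
    hF.measure_coset, Measure.real]

lemma integrable_of_locally_constant (hF : IsUltrametricHaar μ abs q) {f : F → ℂ} {k m : ℤ}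
    (hf : ∀ x h, abs h ≤ q ^ k → f (x + h) = f x) (hf0 : ∀ x, q ^ m < abs x → f x = 0) :
    Integrable f μ := by
  obtain ⟨s, hs⟩ := hF.eq_sum_indicator hf hf0
  rw [funext hs]
  exact integrable_finsetSum s fun c _ => hF.integrable_indicator_coset _ c k

lemma integral_translate (hF : IsUltrametricHaar μ abs q) {f : F → ℂ} {k m : ℤ}
    (hf : ∀ x h, abs h ≤ q ^ k → f (x + h) = f x) (hf0 : ∀ x, q ^ m < abs x → f x = 0) (t : F) :
    ∫ x, f (x + t) ∂μ = ∫ x, f x ∂μ := by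
  obtain ⟨s, hs⟩ := hF.eq_sum_indicator hf hf0
  have hs' : ∀ x, f (x + t) =
      ∑ c ∈ s, {x | abs (x - (c - t)) ≤ q ^ k}.indicator (fun _ => f c) x := fun x => by
    rw [hs (x + t)]
    refine Finset.sum_congr rfl fun c _ => ?_
    simp only [Set.indicator_apply, Set.mem_ofPred_eq, sub_sub_eq_add_sub]
  rw [integral_congr_ae (.of_forall hs), integral_congr_ae (.of_forall hs'),
    integral_finsetSum s fun c _ => hF.integrable_indicator_coset _ _ k,
    integral_finsetSum s fun c _ => hF.integrable_indicator_coset _ _ k]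
  simp only [hF.integral_indicator_coset]

/-- Additive characters trivial on the unit ball are bounded by one. -/
lemma norm_char_le_one (hF : IsUltrametricHaar μ abs q) {ψ : F → ℂ}
    (hψ_add : ∀ x y, ψ (x + y) = ψ x * ψ y) (hψ_triv : ∀ x, abs x ≤ 1 → ψ x = 1) (x : F) :
    ‖ψ x‖ ≤ 1 := by
  obtain ⟨m, hm⟩ := hF.exists_le_zpow x
  obtain ⟨s, hs⟩ := hF.exists_representatives 0 m
  have hpow : ∀ n : ℕ, ψ (n • x) = ψ x ^ n := by
    intro n
    induction n with
    | zero => simp [hψ_triv 0 (by rw [hF.map_zero]; exact zero_le_one)]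
    | succ n ih => rw [succ_nsmul, hψ_add, ih, pow_succ]
  have hbound : ∀ n : ℕ, ‖ψ x‖ ^ n ≤ ∑ c ∈ s, ‖ψ c‖ := by
    intro n
    obtain ⟨c, hc, hxc, -⟩ := hs (n • x) ((hF.ball m).nsmul_mem hm n)
    rw [zpow_zero] at hxc
    have h1 : ψ (n • x) = ψ c := by
      have := hψ_add c (n • x - c)
      rwa [add_sub_cancel, hψ_triv _ hxc, mul_one] at this
    rw [← norm_pow, ← hpow, h1]
    exact Finset.single_le_sum (fun c _ => norm_nonneg (ψ c)) hc
  by_contra! h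
  obtain ⟨n, hn⟩ := pow_unbounded_of_one_lt (∑ c ∈ s, ‖ψ c‖) h
  exact (hn.trans_le (hbound n)).false

section Kloosterman

variable {ψ : F → ℂ} {ξ : F}

lemma phase_add (hF : IsUltrametricHaar μ abs q)
    (hψ_add : ∀ x y, ψ (x + y) = ψ x * ψ y) (hψ_triv : ∀ x, abs x ≤ 1 → ψ x = 1)
    {x h : F} (hx : x ≠ 0) (hh : abs h < abs x) (hh2 : abs h ^ 2 ≤ abs x ^ 3) :
    ψ ((x + h)⁻¹ - ξ * (x + h)) = ψ (x⁻¹ - ξ * x) * ψ (-(h * ((x ^ 2)⁻¹ + ξ))) := by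
  have hax : abs x ≠ 0 := fun h => hx ((hF.eq_zero x).1 h)
  have hxh : abs (x + h) = abs x := hF.add_eq hh
  have hxh0 : x + h ≠ 0 := fun h => hax (by rw [← hxh, h, hF.map_zero])
  have hid : (x + h)⁻¹ - ξ * (x + h) =
      ((x⁻¹ - ξ * x) + -(h * ((x ^ 2)⁻¹ + ξ))) + h ^ 2 * (x ^ 2 * (x + h))⁻¹ := by
    field_simp
    ring
  have hsmall : abs (h ^ 2 * (x ^ 2 * (x + h))⁻¹) ≤ 1 := by
    rw [hF.mul, hF.map_inv, hF.mul, hF.map_pow, hF.map_pow, hxh, ← pow_succ, ← div_eq_mul_inv]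
    exact div_le_one_of_le₀ hh2 (pow_nonneg (hF.nonneg x) 3)
  rw [hid, hψ_add, hψ_triv _ hsmall, mul_one, hψ_add]

/-- The restriction of the oscillating integrand to a sphere is invariant under
a small ball. -/
lemma sphere_invariant (hF : IsUltrametricHaar μ abs q)
    (hψ_add : ∀ x y, ψ (x + y) = ψ x * ψ y) (hψ_triv : ∀ x, abs x ≤ 1 → ψ x = 1)
    {n N : ℤ} (hN : 3 ≤ N) (hξ : abs ξ = q ^ N) (x h : F)
    (hh : abs h ≤ q ^ (-max (2 * n) N)) :
    {x | abs x = q ^ (-n)}.indicator (fun x => ψ (x⁻¹ - ξ * x)) (x + h) =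
      {x | abs x = q ^ (-n)}.indicator (fun x => ψ (x⁻¹ - ξ * x)) x := by
  have hlt : abs h < q ^ (-n) := hh.trans_lt (zpow_lt_zpow_right₀ hF.one_lt (by omega))
  simp only [Set.indicator_apply, Set.mem_ofPred_eq, hF.add_eq_iff hlt]
  split_ifs with hx
  · have hx0 : x ≠ 0 := fun h0 => by
      rw [h0, hF.map_zero] at hx
      exact (zpow_pos hF.q_pos _).ne hx
    rw [hF.phase_add hψ_add hψ_triv hx0 (by rwa [hx]), hψ_triv (-_), mul_one]
    · have h1 : abs ((x ^ 2)⁻¹ + ξ) ≤ q ^ max (2 * n) N := by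
        refine (hF.add _ _).trans (max_le ?_ ?_)
        · rw [hF.map_inv, hF.map_pow, hx, ← zpow_natCast, ← zpow_mul, ← zpow_neg]
          exact hF.zpow_mono (by push_cast; omega)
        · rw [hξ]
          exact hF.zpow_mono (le_max_right _ _)
      rw [hF.map_neg, hF.mul]
      refine (mul_le_mul hh h1 (hF.nonneg _) (zpow_pos hF.q_pos _).le).trans ?_
      rw [← zpow_add₀ hF.q_pos.ne', neg_add_cancel, zpow_zero]
    · refine (pow_le_pow_left₀ (hF.nonneg h) hh 2).trans ?_
      rw [hx, ← zpow_natCast, ← zpow_natCast, ← zpow_mul, ← zpow_mul]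
      exact hF.zpow_mono (by push_cast; omega)
  · rfl

lemma integrable_sphere (hF : IsUltrametricHaar μ abs q)
    (hψ_add : ∀ x y, ψ (x + y) = ψ x * ψ y) (hψ_triv : ∀ x, abs x ≤ 1 → ψ x = 1)
    {n N : ℤ} (hN : 3 ≤ N) (hξ : abs ξ = q ^ N) :
    IntegrableOn (fun x => ψ (x⁻¹ - ξ * x)) {x | abs x = q ^ (-n)} μ := by
  rw [← integrable_indicator_iff (hF.measurableSet_sphere _)]
  exact hF.integrable_of_locally_constant (hF.sphere_invariant hψ_add hψ_triv hN hξ)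
    (m := -n) fun x hx => Set.indicator_apply_eq_zero.2 fun h => absurd h hx.ne'

lemma integral_sphere_eq_zero (hF : IsUltrametricHaar μ abs q)
    (hψ_add : ∀ x y, ψ (x + y) = ψ x * ψ y) (hψ_triv : ∀ x, abs x ≤ 1 → ψ x = 1)
    (hψ_nontriv : ∃ x, abs x ≤ q ∧ ψ x ≠ 1)
    {n N : ℤ} (hN : 3 ≤ N) (hξ : abs ξ = q ^ N) (hnN : 2 * n ≠ N) :
    ∫ x in {x | abs x = q ^ (-n)}, ψ (x⁻¹ - ξ * x) ∂μ = 0 := by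
  set M := max (2 * n) N with hM
  set g : F → ℂ := {x | abs x = q ^ (-n)}.indicator (fun x => ψ (x⁻¹ - ξ * x)) with hg
  have hginv : ∀ x h, abs h ≤ q ^ (-M) → g (x + h) = g x :=
    hF.sphere_invariant hψ_add hψ_triv hN hξ
  have hg0 : ∀ x, q ^ (-n) < abs x → g x = 0 := fun x hx =>
    Set.indicator_apply_eq_zero.2 fun h => absurd h hx.ne'
  rw [← integral_indicator (hF.measurableSet_sphere _)]
  change ∫ x, g x ∂μ = 0
  obtain ⟨s, hs⟩ := hF.exists_representatives (1 - M) (-n)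
  -- translates of the ball of radius `q ^ (1 - M)`, and `g` cut off to one of them
  have hball : ∀ c x h, abs h ≤ q ^ (1 - M) →
      (abs (x + h - c) ≤ q ^ (1 - M) ↔ abs (x - c) ≤ q ^ (1 - M)) := fun c x h hh => by
    rw [add_sub_right_comm]
    exact (hF.ball (1 - M)).add_mem_cancel_right (x := h) (y := x - c) hh
  let G : F → F → ℂ := fun c => {x | abs (x - c) ≤ q ^ (1 - M)}.indicator g
  have hGinv : ∀ c x h, abs h ≤ q ^ (-M) → G c (x + h) = G c x := fun c x h hh => by
    simp only [G, Set.indicator_apply, Set.mem_ofPred_eq, hginv x h hh,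
      hball c x h (hh.trans (hF.zpow_mono (by omega)))]
  have hG0 : ∀ c x, q ^ (-n) < abs x → G c x = 0 := fun c x hx =>
    Set.indicator_apply_eq_zero.2 fun _ => hg0 x hx
  have hsum : ∀ x, g x = ∑ c ∈ s, G c x := fun x => by
    by_cases hx : abs x ≤ q ^ (-n)
    · obtain ⟨c, hc, hxc, hu⟩ := hs x hx
      have h0 : ∀ d ∈ s, d ≠ c → G d x = 0 := fun d hd hdc =>
        Set.indicator_apply_eq_zero.2 fun hxd => absurd (hu d hd hxd) hdc
      rw [Finset.sum_eq_single_of_mem c hc h0]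
      exact (Set.indicator_of_mem (show x ∈ {x | abs (x - c) ≤ q ^ (1 - M)} from hxc) g).symm
    · rw [hg0 x (not_le.1 hx), Finset.sum_eq_zero fun c _ => hG0 c x (not_le.1 hx)]
  rw [integral_congr_ae (.of_forall hsum), integral_finsetSum s fun c _ =>
    hF.integrable_of_locally_constant (hGinv c) (hG0 c)]
  refine Finset.sum_eq_zero fun c _ => ?_
  by_cases hex : ∃ x₀, abs (x₀ - c) ≤ q ^ (1 - M) ∧ abs x₀ = q ^ (-n)
  swap
  · rw [integral_congr_ae (g := 0) (.of_forall fun x => ?_)]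
    · simp
    · exact Set.indicator_apply_eq_zero.2 fun hxc => Set.indicator_apply_eq_zero.2 fun hx =>
        absurd ⟨x, hxc, hx⟩ hex
  obtain ⟨x₀, hx₀c, hx₀⟩ := hex
  have hx₀0 : x₀ ≠ 0 := fun h0 => by
    rw [h0, hF.map_zero] at hx₀
    exact (zpow_pos hF.q_pos _).ne hx₀
  set C := (x₀ ^ 2)⁻¹ + ξ with hC
  have hCabs : abs C = q ^ M := by
    have h1 : abs (x₀ ^ 2)⁻¹ = q ^ (2 * n) := by
      rw [hF.map_inv, hF.map_pow, hx₀, ← zpow_natCast, ← zpow_mul, ← zpow_neg]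
      congr 1
      push_cast
      ring
    rcases lt_or_gt_of_ne hnN with h | h
    · rw [hM, max_eq_right h.le, ← hξ, hC, add_comm]
      refine hF.add_eq ?_
      rw [h1, hξ]
      exact zpow_lt_zpow_right₀ hF.one_lt h
    · rw [hM, max_eq_left h.le, ← h1, hC]
      refine hF.add_eq ?_
      rw [h1, hξ]
      exact zpow_lt_zpow_right₀ hF.one_lt h
  have hC0 : C ≠ 0 := fun h0 => by
    rw [h0, hF.map_zero] at hCabs
    exact (zpow_pos hF.q_pos _).ne hCabs
  have hlt : ∀ h, abs h ≤ q ^ (1 - M) → abs h < q ^ (-n) := fun h hh =>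
    hh.trans_lt (zpow_lt_zpow_right₀ hF.one_lt (by omega))
  have hgx₀ : ∀ u, abs u ≤ q ^ (1 - M) →
      g (x₀ + u) = ψ (x₀⁻¹ - ξ * x₀) * ψ (-(u * C)) := fun u hu => by
    have hmem : x₀ + u ∈ {x | abs x = q ^ (-n)} := (hF.add_eq_iff (hlt u hu)).2 hx₀
    rw [hg, Set.indicator_of_mem hmem]
    refine hF.phase_add hψ_add hψ_triv hx₀0 (by rw [hx₀]; exact hlt u hu) ?_
    refine (pow_le_pow_left₀ (hF.nonneg u) hu 2).trans ?_
    rw [hx₀, ← zpow_natCast, ← zpow_natCast, ← zpow_mul, ← zpow_mul]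
    exact hF.zpow_mono (by push_cast; omega)
  obtain ⟨y, hy, hψy⟩ := hψ_nontriv
  set h₀ := -(y * C⁻¹) with hh₀
  have hh₀abs : abs h₀ ≤ q ^ (1 - M) := by
    rw [hh₀, hF.map_neg, hF.mul, hF.map_inv, hCabs, zpow_sub₀ hF.q_pos.ne', zpow_one,
      div_eq_mul_inv]
    exact mul_le_mul_of_nonneg_right hy (inv_nonneg.2 (zpow_pos hF.q_pos _).le)
  have htrans : ∀ x, G c (x + h₀) = ψ y * G c x := fun x => by
    simp only [G, Set.indicator_apply, Set.mem_ofPred_eq, hball c x h₀ hh₀abs]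
    split_ifs with hxc
    · have hu : abs (x - x₀) ≤ q ^ (1 - M) := by
        have h1 := (hF.ball (1 - M)).sub_mem hxc hx₀c
        rwa [sub_sub_sub_cancel_right] at h1
      have e1 : g x = ψ (x₀⁻¹ - ξ * x₀) * ψ (-((x - x₀) * C)) := by
        rw [← hgx₀ _ hu, add_sub_cancel]
      have e2 : g (x + h₀) = ψ (x₀⁻¹ - ξ * x₀) * ψ (-((x - x₀ + h₀) * C)) := by
        rw [← hgx₀ _ ((hF.ball (1 - M)).add_mem hu hh₀abs), ← add_assoc, add_sub_cancel]
      have e3 : -((x - x₀ + h₀) * C) = y + -((x - x₀) * C) := by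
        rw [hh₀]
        field_simp
        ring
      rw [e2, e3, hψ_add, e1]
      ring
    · rw [mul_zero]
  have hint := hF.integral_translate (hGinv c) (hG0 c) h₀
  rw [integral_congr_ae (.of_forall htrans), integral_const_mul] at hint
  by_contra hne
  exact hψy (mul_right_cancel₀ hne (by rw [hint, one_mul]))

end Kloosterman

end IsUltrametricHaar


/-- For a nonarchimedean local field `F` with character `ψ` of conductor `𝔬` and
`|ξ| > q²`, only the stratum `|x|² = |ξ|⁻¹` contributes to `∫_𝔬 ψ(x⁻¹ - ξx) dx`. -/
theorem stmt_8 {F : Type*} [Field F] [MeasurableSpace F]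
    (μ : Measure F) (abs : F → ℝ) (q : ℝ) (ψ : F → ℂ)
    (hq : 1 < q)
    (habs_meas : Measurable abs)
    (habs_nonneg : ∀ x, 0 ≤ abs x)
    (habs_eq_zero : ∀ x, abs x = 0 ↔ x = 0)
    (habs_mul : ∀ x y, abs (x * y) = abs x * abs y)
    (habs_add : ∀ x y, abs (x + y) ≤ max (abs x) (abs y))
    (habs_vals : ∀ x : F, x ≠ 0 → ∃ n : ℤ, abs x = q ^ n)
    (hμ_inv : ∀ (a : F) (s : Set F), MeasurableSet s → μ ((fun x => a + x) ⁻¹' s) = μ s)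
    (hμ_fin : ∀ n : ℤ, μ {x : F | abs x ≤ q ^ n} < ⊤)
    (hμ_int : μ {x : F | abs x ≤ 1} = 1)
    (hψ_meas : Measurable ψ)
    (hψ_add : ∀ x y, ψ (x + y) = ψ x * ψ y)
    (hψ_triv : ∀ x, abs x ≤ 1 → ψ x = 1)
    (hψ_nontriv : ∃ x, abs x ≤ q ∧ ψ x ≠ 1)
    (ξ : F) (hξ : q ^ 2 < abs ξ) :
    ∫ x in {x : F | abs x ≤ 1}, ψ (x⁻¹ - ξ * x) ∂μ
      = ∫ x in {x : F | (abs x) ^ 2 = (abs ξ)⁻¹}, ψ (x⁻¹ - ξ * x) ∂μ := by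
  have hF : IsUltrametricHaar μ abs q := by
    refine ⟨hq, habs_meas, habs_nonneg, habs_eq_zero, habs_mul, habs_add, habs_vals, ?_, hμ_inv,
      hμ_fin, hμ_int⟩
    obtain ⟨y, hy, hψy⟩ := hψ_nontriv
    have h1 : 1 < abs y := not_le.1 fun h => hψy (hψ_triv y h)
    obtain ⟨n, hn⟩ := habs_vals y fun h0 => by
      rw [(habs_eq_zero y).2 h0] at h1
      exact absurd h1 (by norm_num)
    rw [hn] at h1 hy
    have h2 : 0 < n := (one_lt_zpow_iff_right₀ hq).1 h1
    have h3 : n ≤ 1 := (zpow_le_zpow_iff_right₀ hq).1 (by rwa [zpow_one])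
    exact ⟨y, by rw [hn, show n = 1 by omega, zpow_one]⟩
  have hq0 := hF.q_pos
  obtain ⟨N, hN⟩ := habs_vals ξ fun h0 => by
    rw [(habs_eq_zero ξ).2 h0] at hξ
    exact absurd hξ (not_lt.2 (by positivity))
  have hN3 : 3 ≤ N := by
    rw [hN, ← zpow_natCast, zpow_lt_zpow_iff_right₀ hq] at hξ
    push_cast at hξ
    omega
  set f : F → ℂ := fun x => ψ (x⁻¹ - ξ * x)
  set O : Set F := {x | abs x ≤ 1}
  set S : Set F := {x | abs x ^ 2 = (abs ξ)⁻¹} with hS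
  have hSm : MeasurableSet S := (habs_meas.pow_const 2) (measurableSet_singleton _)
  have hOfin : μ O ≠ ⊤ := by rw [hμ_int]; exact ENNReal.one_ne_top
  have hξ1 : (abs ξ)⁻¹ ≤ 1 := by
    rw [hN]
    exact inv_le_one_of_one_le₀ (one_le_zpow₀ hq.le (by omega))
  have hSO : S ⊆ O := fun x hx => by
    rw [hS, Set.mem_ofPred_eq] at hx
    exact (pow_le_one_iff_of_nonneg (habs_nonneg x) two_ne_zero).1 (hx ▸ hξ1)
  let T : ℕ → Set F := fun n => {x | abs x = q ^ (-(n : ℤ))}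
  have hTm : ∀ n, MeasurableSet (T n) := fun n => hF.measurableSet_sphere _
  have hTdisj : Pairwise (Function.onFun Disjoint T) := fun a b hab =>
    Set.disjoint_left.2 fun x (hxa : abs x = _) (hxb : abs x = _) => hab (by
      have := zpow_right_injective₀ hq0 hq.ne' (hxa.symm.trans hxb)
      simpa using this)
  have hz : ∀ᵐ x ∂μ, x ≠ 0 := by
    rw [ae_iff]
    simpa using hF.measure_zero_singleton
  have hOT : O =ᵐ[μ] ⋃ n, T n := by
    filter_upwards [hz] with x hx
    refine propext ⟨fun hxO => ?_, fun hxT => ?_⟩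
    · obtain ⟨m, hm⟩ := habs_vals x hx
      have hxO' : abs x ≤ 1 := hxO
      rw [hm, zpow_le_one_iff_right₀ hq] at hxO'
      refine Set.mem_iUnion.2 ⟨(-m).toNat, ?_⟩
      change abs x = _
      rw [hm]
      congr 1
      omega
    · obtain ⟨n, hn⟩ := Set.mem_iUnion.1 hxT
      have hn' : abs x = _ := hn
      change abs x ≤ 1
      rw [hn', zpow_le_one_iff_right₀ hq]
      omega
  have hint : IntegrableOn f O μ := by
    refine Integrable.mono' (g := fun _ => 1) (integrableOn_const hOfin) ?_
      (.of_forall fun x => hF.norm_char_le_one hψ_add hψ_triv _)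
    rw [Measure.restrict_congr_set hOT]
    exact aestronglyMeasurable_iUnion_iff.2 fun n =>
      (hF.integrable_sphere hψ_add hψ_triv hN3 hN).1
  have hzero : ∫ x in O \ S, f x ∂μ = 0 := by
    have hae : (O \ S : Set F) =ᵐ[μ] ⋃ n, T n \ S := by
      rw [← Set.iUnion_sdiff]
      exact hOT.diff (ae_eq_refl S)
    rw [setIntegral_congr_set hae, integral_iUnion (fun n => (hTm n).diff hSm)
      (fun a b hab => (hTdisj hab).mono Set.sdiff_subset Set.sdiff_subset)
      ((hint.mono_set Set.sdiff_subset).congr_set_ae hae.symm)]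
    refine (tsum_congr fun n => ?_).trans tsum_zero
    have hmem : ∀ x ∈ T n, x ∈ S ↔ 2 * (n : ℤ) = N := fun x (hx : abs x = _) => by
      rw [hS, Set.mem_ofPred_eq, hx, hN, ← zpow_natCast, ← zpow_mul, ← zpow_neg,
        (zpow_right_injective₀ hq0 hq.ne').eq_iff]
      push_cast
      omega
    by_cases hnN : 2 * (n : ℤ) = N
    · rw [Set.sdiff_eq_empty.2 fun x hx => (hmem x hx).2 hnN, setIntegral_empty]
    · rw [(Set.disjoint_left.2 fun x hx hxS => hnN ((hmem x hx).1 hxS)).sdiff_eq_left]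
      exact hF.integral_sphere_eq_zero hψ_add hψ_triv hψ_nontriv hN3 hN hnN
  rw [← integral_inter_add_sdiff hSm hint, hzero, add_zero, Set.inter_eq_self_of_subset_right hSO]
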